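/- Let A be the companion matrix of f(x) = (x-1)^5 and B the companion matrix of g(x) = (x+1)(x⁴−x³+x²−x+1), and set T = B·A⁻¹ in GL(5,ℚ). Then T² = I with T ≠ ±I, B has order 10 with B⁵ = −I, and the hypergeometric group Γ(f,g) = ⟨A,B⟩ is the amalgamated free product of the subgroup G₁ generated by −I and T (a group of order 4) and the subgroup G₂ generated by B (cyclic of order 10), amalgamated over their common subgroup {I, −I}: the canonical group homomorphism from the abstract amalgamated free product G₁ ∗_{⟨−I⟩} G₂ to GL(5,ℚ) induced by the inclusions of G₁ and G₂ is injective with image Γ(f,g). -/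

import Mathlib

open Polynomial Matrix

/-- The companion matrix of a monic degree-5 rational polynomial `p`:
the `5 × 5` matrix whose entries in position `(i+1, i)` equal `1` for
`i = 1, ..., 4`, whose last column is `(-p₀, -p₁, -p₂, -p₃, -p₄)ᵀ`
(where `pᵢ` is the coefficient of `xⁱ` in `p`), and whose remaining
entries are `0`. -/
def companionMatrix (p : ℚ[X]) : Matrix (Fin 5) (Fin 5) ℚ :=
  Matrix.of fun i j : Fin 5 =>
    if (j : ℕ) = 4 then -p.coeff i
    else if (i : ℕ) = (j : ℕ) + 1 then 1 else 0

/-- A two-member family of types indexed by `Bool`. -/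
abbrev boolFam (X Y : Type u) : Bool → Type u
  | true => X
  | false => Y

instance boolFamGroup (X Y : Type u) [Group X] [Group Y] : ∀ b, Group (boolFam X Y b)
  | true => inferInstanceAs (Group X)
  | false => inferInstanceAs (Group Y)

/-- The pair of inclusion homomorphisms `H →* G₁`, `H →* G₂` of a subgroup `H`
contained in two subgroups `G₁`, `G₂` of an ambient group, as a `Bool`-indexed
family.  `Monoid.PushoutI` applied to this family is the abstract amalgamated
free product `G₁ ∗_H G₂`. -/
def boolFamIncl {G : Type*} [Group G] {H G₁ G₂ : Subgroup G} (h₁ : H ≤ G₁) (h₂ : H ≤ G₂) :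
    ∀ b, ↥H →* boolFam ↥G₁ ↥G₂ b
  | true => Subgroup.inclusion h₁
  | false => Subgroup.inclusion h₂


namespace Monoid.PushoutI

section PingPong

variable {ι H K α : Type*} {G : ι → Type*} [∀ i, Group (G i)] [Group H] [Group K] [MulAction K α]
  {φ : ∀ i, H →* G i}

/-- `g` maps every set `X k` with `k ≠ j` into `X i`, and if `j = i₀`, it also maps some point
of `X i₀` into `X i`. -/
def MapsPingPong (X : ι → Set α) (i₀ i j : ι) (g : K) : Prop :=
  (∀ k, k ≠ j → ∀ v ∈ X k, g • v ∈ X i) ∧ (j = i₀ → ∃ v ∈ X i₀, g • v ∈ X i)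

theorem MapsPingPong.mul {X : ι → Set α} {i₀ i j k l : ι} {g g' : K}
    (hg : MapsPingPong X i₀ i j g) (hjk : j ≠ k) (hg' : MapsPingPong X i₀ k l g') :
    MapsPingPong X i₀ i l (g * g') := by
  refine ⟨fun m hm v hv => ?_, fun hl => ?_⟩
  · rw [mul_smul]
    exact hg.1 k hjk.symm _ (hg'.1 m hm v hv)
  · obtain ⟨v, hv, hv'⟩ := hg'.2 hl
    refine ⟨v, hv, ?_⟩
    rw [mul_smul]
    exact hg.1 k hjk.symm _ hv'

/-- An element preserving each of the disjoint sets `X i` is not of ping-pong type. -/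
theorem not_mapsPingPong [Nontrivial ι] {X : ι → Set α} (hne : ∀ i, (X i).Nonempty)
    (hdisj : ∀ i j, i ≠ j → Disjoint (X i) (X j)) {i₀ i j : ι} {g : K}
    (hg : ∀ k, ∀ v ∈ X k, g • v ∈ X k) (hg' : ∀ k, ∀ v ∈ X k, g⁻¹ • v ∈ X k)
    (h : MapsPingPong X i₀ i j g) (h' : MapsPingPong X i₀ j i g⁻¹) : False := by
  have key : ∀ {i k : ι} {w : α}, w ∈ X k → w ∈ X i → k = i := fun hk hi => by
    by_contra hki
    exact Set.disjoint_left.mp (hdisj _ _ hki) hk hi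
  by_cases hij : i = j
  · obtain ⟨k, hk⟩ := exists_ne j
    obtain ⟨v, hv⟩ := hne k
    exact hk ((key (hg k v hv) (h.1 k hk v hv)).trans hij)
  by_cases hj : j = i₀
  · obtain ⟨v, hv, hv'⟩ := h.2 hj
    exact hij ((key (hg i₀ v hv) hv').symm.trans hj.symm)
  by_cases hi : i = i₀
  · obtain ⟨v, hv, hv'⟩ := h'.2 hi
    exact hij (hi.trans (key (hg' i₀ v hv) hv'))
  · obtain ⟨v, hv⟩ := hne i₀
    exact hi (key (hg i₀ v hv) (h.1 i₀ (Ne.symm hj) v hv)).symm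

theorem mapsPingPong_neWord {X : ι → Set α} {i₀ : ι} (ψ : PushoutI φ →* K)
    (hpp : ∀ i, ∀ g : G i, g ∉ (φ i).range → MapsPingPong X i₀ i i (ψ (of i g)))
    {i j : ι} (w : CoprodI.NeWord G i j) (hw : ∀ g ∈ w.toList, g.2 ∉ (φ g.1).range) :
    MapsPingPong X i₀ i j (ψ (ofCoprodI w.prod)) ∧
      MapsPingPong X i₀ j i (ψ (ofCoprodI w.prod))⁻¹ := by
  induction w with
  | @singleton i g hg =>
    have hg' : g ∉ (φ i).range := hw ⟨i, g⟩ (by simp)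
    rw [CoprodI.NeWord.prod_singleton, ofCoprodI_of, ← map_inv, ← map_inv]
    exact ⟨hpp i g hg', hpp i g⁻¹ (fun h => hg' (by simpa using h))⟩
  | append w₁ hne w₂ ih₁ ih₂ =>
    have h₁ := ih₁ fun g hg => hw g (by simp [hg])
    have h₂ := ih₂ fun g hg => hw g (by simp [hg])
    rw [CoprodI.NeWord.append_prod, map_mul, map_mul, _root_.mul_inv_rev]
    exact ⟨h₁.1.mul hne h₂.1, h₂.2.mul hne.symm h₁.2⟩

/-- The letters of a normal word do not lie in the base group. -/
theorem NormalWord.reduced {d : NormalWord.Transversal φ} (w : NormalWord d) :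
    Reduced φ w.toWord := by
  rintro ⟨i, g⟩ hg hmem
  refine w.ne_one _ hg ?_
  have h := (d.compl i).1
    (a₁ := (⟨g, hmem⟩, ⟨1, d.one_mem i⟩)) (a₂ := (⟨1, one_mem _⟩, ⟨g, w.normalized i g hg⟩))
    (by simp)
  simpa using congrArg (fun p => (p.1 : G i)) h

/-- The ping-pong lemma for amalgamated products. -/
theorem injective_of_ping_pong [Nontrivial ι] (hφ : ∀ i, Function.Injective (φ i))
    (ψ : PushoutI φ →* K) (X : ι → Set α) (i₀ : ι) (hne : ∀ i, (X i).Nonempty)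
    (hdisj : ∀ i j, i ≠ j → Disjoint (X i) (X j))
    (hinj : ∀ h, ψ (base φ h) = 1 → h = 1)
    (hbase : ∀ h i, ∀ v ∈ X i, ψ (base φ h) • v ∈ X i)
    (hpp : ∀ i, ∀ g : G i, g ∉ (φ i).range → MapsPingPong X i₀ i i (ψ (of i g))) :
    Function.Injective ψ := by
  classical
  obtain ⟨d⟩ := NormalWord.transversal_nonempty φ hφ
  rw [injective_iff_map_eq_one]
  intro x hx
  obtain ⟨w, rfl⟩ : ∃ w : NormalWord d, w.prod = x :=
    ⟨NormalWord.equiv x, NormalWord.equiv.symm_apply_apply x⟩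
  rw [NormalWord.prod, map_mul] at hx
  by_cases hw : w.toWord = .empty
  · simp only [hw, CoprodI.Word.prod_empty, map_one, mul_one] at hx
    simp [NormalWord.prod, hw, hinj _ hx]
  · obtain ⟨i, j, w', hw'⟩ := CoprodI.NeWord.of_word w.toWord hw
    have hred : ∀ g ∈ w'.toList, g.2 ∉ (φ g.1).range := by
      have := w.reduced
      rw [← hw'] at this
      exact this
    have h := mapsPingPong_neWord ψ hpp w' hred
    have heq : ψ (ofCoprodI w'.prod) = ψ (base φ w.head⁻¹) := by
      rw [map_inv, map_inv, CoprodI.NeWord.prod, hw']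
      exact eq_inv_of_mul_eq_one_right hx
    rw [heq] at h
    refine (not_mapsPingPong hne hdisj (hbase _) (fun k v hv => ?_) h.1 h.2).elim
    rw [← map_inv, ← map_inv]
    exact hbase _ k v hv

end PingPong

end Monoid.PushoutI

/-! ### An invariant cone -/

/-- Half of the inequalities cutting out the polyhedral cone `IsInCone`; the other half is
obtained by reversing the order of the last four coordinates. -/
structure HalfCone (a b c d e : ℚ) : Prop where
  pos₁ : 0 < -a + b
  pos₂ : 0 < -a + c
  pos₃ : 0 < -2 * a - b + 29 * c - 17 * d + 8 * e
  pos₄ : 0 < -2 * a + b + 5 * c - 4 * d + 3 * e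
  pos₅ : 0 < -a + b + 2 * c - 8 * d + 17 * e
  pos₆ : 0 < -b + 2 * c - 3 * d + 4 * e
  pos₇ : 0 < a - b + c - d + e
  pos₈ : 0 < a - c - d + 9 * e
  pos₉ : 0 < 3 * a - 4 * b + 5 * c + d - 2 * e

/-- The open polyhedral cone with 18 facets used for the ping-pong argument. -/
def IsInCone (a b c d e : ℚ) : Prop :=
  HalfCone a b c d e ∧ HalfCone a e d c b

theorem IsInCone.reverse {a b c d e : ℚ} (h : IsInCone a b c d e) : IsInCone a e d c b :=
  ⟨h.2, h.1⟩

theorem IsInCone.map_one {a b c d e : ℚ} (h : IsInCone a b c d e) :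
    IsInCone e (5 * e - a) (10 * e - b) (10 * e - c) (5 * e - d) := by
  obtain ⟨⟨h₁, h₂, h₃, h₄, h₅, h₆, h₇, h₈, h₉⟩, ⟨k₁, k₂, k₃, k₄, k₅, k₆, k₇, k₈, k₉⟩⟩ := h
  constructor <;> constructor <;> linarith

theorem IsInCone.map_two {a b c d e : ℚ} (h : IsInCone a b c d e) :
    IsInCone d (5 * d - e) (10 * d - a) (10 * d - b) (5 * d - c) := by
  obtain ⟨⟨h₁, h₂, h₃, h₄, h₅, h₆, h₇, h₈, h₉⟩, ⟨k₁, k₂, k₃, k₄, k₅, k₆, k₇, k₈, k₉⟩⟩ := h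
  constructor <;> constructor <;> linarith

theorem IsInCone.map_three {a b c d e : ℚ} (h : IsInCone a b c d e) :
    IsInCone c (5 * c - d) (10 * c - e) (10 * c - a) (5 * c - b) :=
  h.reverse.map_two.reverse

theorem IsInCone.map_four {a b c d e : ℚ} (h : IsInCone a b c d e) :
    IsInCone b (5 * b - c) (10 * b - d) (10 * b - e) (5 * b - a) :=
  h.reverse.map_one.reverse

theorem IsInCone.first_lt {a b c d e : ℚ} (h : IsInCone a b c d e) :
    a < b ∧ a < c ∧ a < d ∧ a < e :=
  ⟨by linarith [h.1.pos₁], by linarith [h.1.pos₂], by linarith [h.2.pos₂], by linarith [h.2.pos₁]⟩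

theorem IsInCone.sum_pos {a b c d e : ℚ} (h : IsInCone a b c d e) : 0 < a + b + c + d + e := by
  obtain ⟨⟨h₁, h₂, h₃, h₄, h₅, h₆, h₇, h₈, h₉⟩, ⟨k₁, k₂, k₃, k₄, k₅, k₆, k₇, k₈, k₉⟩⟩ := h
  linarith

/-! ### Subgroups generated by `-1`, `T` and `B` -/

section Subgroups

variable {G : Type*} [Group G] [HasDistribNeg G]

theorem mem_closure_neg_one {x : G} :
    x ∈ Subgroup.closure ({-1} : Set G) ↔ x = 1 ∨ x = -1 := by
  constructor
  · intro hx
    induction hx using Subgroup.closure_induction with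
    | mem x hx => exact Or.inr hx
    | one => exact Or.inl rfl
    | mul x y _ _ hx hy => rcases hx with rfl | rfl <;> rcases hy with rfl | rfl <;> simp
    | inv x _ hx => rcases hx with rfl | rfl <;> simp
  · rintro (rfl | rfl)
    · exact one_mem _
    · exact Subgroup.subset_closure rfl

theorem mem_closure_neg_one_involution {T x : G} (hT : T ^ 2 = 1) :
    x ∈ Subgroup.closure ({-1, T} : Set G) ↔ x = 1 ∨ x = -1 ∨ x = T ∨ x = -T := by
  have hTT : T * T = 1 := by rw [← sq, hT]
  have hTi : T⁻¹ = T := inv_eq_of_mul_eq_one_right hTT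
  have hneg : -1 ∈ Subgroup.closure ({-1, T} : Set G) := Subgroup.subset_closure (by simp)
  have hmem : T ∈ Subgroup.closure ({-1, T} : Set G) := Subgroup.subset_closure (by simp)
  constructor
  · intro hx
    induction hx using Subgroup.closure_induction with
    | mem x hx => rcases hx with rfl | rfl <;> simp
    | one => exact Or.inl rfl
    | mul x y _ _ hx hy =>
      rcases hx with rfl | rfl | rfl | rfl <;> rcases hy with rfl | rfl | rfl | rfl <;> simp [hTT]
    | inv x _ hx => rcases hx with rfl | rfl | rfl | rfl <;> simp [hTi, inv_neg]
  · rintro (rfl | rfl | rfl | rfl)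
    · exact one_mem _
    · exact hneg
    · exact hmem
    · simpa using mul_mem hneg hmem

theorem eq_pow_or_neg_of_mem_closure {B x : G} (hB : B ^ 5 = -1)
    (hx : x ∈ Subgroup.closure ({B} : Set G)) : ∃ k < 5, x = B ^ k ∨ x = -B ^ k := by
  rw [Subgroup.mem_closure_singleton] at hx
  obtain ⟨n, rfl⟩ := hx
  have h10 : B ^ 10 = 1 := by
    rw [show 10 = 5 * 2 from rfl, pow_mul, hB]
    simp
  obtain ⟨m, hm, hmn⟩ : ∃ m < 10, B ^ n = B ^ m := by
    refine ⟨(n % 10).toNat, by omega, ?_⟩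
    rw [← zpow_natCast, Int.toNat_of_nonneg (by omega)]
    conv_lhs => rw [← Int.emod_add_mul_ediv n 10, _root_.zpow_add, _root_.zpow_mul]
    simp [show B ^ (10 : ℤ) = 1 from mod_cast h10]
  rw [hmn]
  by_cases h : m < 5
  · exact ⟨m, h, Or.inl rfl⟩
  · refine ⟨m - 5, by omega, Or.inr ?_⟩
    obtain ⟨j, rfl⟩ : ∃ j, m = 5 + j := ⟨m - 5, by omega⟩
    simp [pow_add, hB]

end Subgroups

/-- The inclusions of two subgroups as a `Bool`-indexed family. -/
def boolFamSubtype {G : Type*} [Group G] (G₁ G₂ : Subgroup G) :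
    ∀ b, boolFam ↥G₁ ↥G₂ b →* G
  | true => G₁.subtype
  | false => G₂.subtype

theorem boolFamSubtype_comp_incl {G : Type*} [Group G] {H G₁ G₂ : Subgroup G}
    (h₁ : H ≤ G₁) (h₂ : H ≤ G₂) (b : Bool) :
    (boolFamSubtype G₁ G₂ b).comp (boolFamIncl h₁ h₂ b) = H.subtype := by
  cases b <;> rfl

theorem boolFamIncl_injective {G : Type*} [Group G] {H G₁ G₂ : Subgroup G}
    (h₁ : H ≤ G₁) (h₂ : H ≤ G₂) (b : Bool) : Function.Injective (boolFamIncl h₁ h₂ b) := by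
  cases b
  · exact Subgroup.inclusion_injective h₂
  · exact Subgroup.inclusion_injective h₁

theorem mem_range_boolFamIncl_true {G : Type*} [Group G] {H G₁ G₂ : Subgroup G}
    (h₁ : H ≤ G₁) (h₂ : H ≤ G₂) {x : G₁} (hx : (x : G) ∈ H) :
    x ∈ (boolFamIncl h₁ h₂ true).range :=
  ⟨⟨x, hx⟩, rfl⟩

theorem mem_range_boolFamIncl_false {G : Type*} [Group G] {H G₁ G₂ : Subgroup G}
    (h₁ : H ≤ G₁) (h₂ : H ≤ G₂) {x : G₂} (hx : (x : G) ∈ H) :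
    x ∈ (boolFamIncl h₁ h₂ false).range :=
  ⟨⟨x, hx⟩, rfl⟩

/-! ### The ping-pong sets -/

/-- The cone `IsInCone` in coordinates with alternating signs. -/
def SignedCone (v : Fin 5 → ℚ) : Prop :=
  IsInCone (v 0) (-v 1) (v 2) (-v 3) (v 4)

/-- The ping-pong sets for the action of `⟨-1, T⟩` and `⟨B⟩`. -/
def pingPongSet (B : GL (Fin 5) ℚ) : Bool → Set (Fin 5 → ℚ)
  | true => {v | SignedCone v ∨ SignedCone (-v)}
  | false => {v | ∃ k, 1 ≤ k ∧ k ≤ 4 ∧ ∃ u, (SignedCone u ∨ SignedCone (-u)) ∧ v = B ^ k • u}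

theorem GL.neg_smul {n : Type*} [Fintype n] [DecidableEq n] {R : Type*} [CommRing R]
    (g : GL n R) (v : n → R) : (-g) • v = -(g • v) :=
  _root_.neg_smul (g : Matrix n n R) v

section Action

variable {B T : GL (Fin 5) ℚ}

theorem neg_mem_pingPongSet {b : Bool} {v : Fin 5 → ℚ} (hv : v ∈ pingPongSet B b) :
    -v ∈ pingPongSet B b := by
  cases b
  · obtain ⟨k, hk₁, hk₂, u, hu, rfl⟩ := hv
    exact ⟨k, hk₁, hk₂, -u, by simpa using hu.symm, by rw [smul_neg]⟩
  · show SignedCone (-v) ∨ SignedCone (- -v)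
    rw [neg_neg]
    exact hv.symm

theorem pingPongSet_nonempty (b : Bool) : (pingPongSet B b).Nonempty := by
  have h : SignedCone ![1, -2, 2, -2, 2] := by
    constructor <;> constructor <;> simp <;> norm_num
  cases b
  · exact ⟨_, 1, le_rfl, by norm_num, _, Or.inl h, rfl⟩
  · exact ⟨_, Or.inl h⟩

theorem disjoint_pingPongSet (hB : ∀ v : Fin 5 → ℚ, B • v = ![-v 4, v 0, v 1, v 2, v 3]) :
    Disjoint (pingPongSet B true) (pingPongSet B false) := by
  rw [Set.disjoint_left]
  rintro v hv ⟨k, hk₁, hk₂, u, hu, rfl⟩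
  interval_cases k <;> rcases hv with hv | hv <;> rcases hu with hu | hu <;>
  · have h₁ := hv.first_lt
    have h₂ := hv.sum_pos
    have h₃ := hu.first_lt
    have h₄ := hu.sum_pos
    simp [pow_succ, mul_smul, hB] at h₁ h₂ h₃ h₄
    linarith

theorem smul_pow_smul_mem (hB : ∀ v : Fin 5 → ℚ, B • v = ![-v 4, v 0, v 1, v 2, v 3])
    (hT : ∀ v : Fin 5 → ℚ,
      T • v = ![-v 0, 5 * v 0 + v 1, -10 * v 0 + v 2, 10 * v 0 + v 3, -5 * v 0 + v 4])
    {k : ℕ} (hk₁ : 1 ≤ k) (hk₂ : k ≤ 4) {u : Fin 5 → ℚ} (hu : SignedCone u) :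
    T • B ^ k • u ∈ pingPongSet B true := by
  interval_cases k
  · left
    show IsInCone _ _ _ _ _
    convert IsInCone.map_one hu using 1 <;> simp [pow_succ, hB, hT] <;> ring
  · right
    show IsInCone _ _ _ _ _
    convert IsInCone.map_two hu using 1 <;> simp [pow_succ, mul_smul, hB, hT] <;> ring
  · left
    show IsInCone _ _ _ _ _
    convert IsInCone.map_three hu using 1 <;> simp [pow_succ, mul_smul, hB, hT] <;> ring
  · right
    show IsInCone _ _ _ _ _
    convert IsInCone.map_four hu using 1 <;> simp [pow_succ, mul_smul, hB, hT] <;> ring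

theorem smul_mem_pingPongSet_true (hB : ∀ v : Fin 5 → ℚ, B • v = ![-v 4, v 0, v 1, v 2, v 3])
    (hT : ∀ v : Fin 5 → ℚ,
      T • v = ![-v 0, 5 * v 0 + v 1, -10 * v 0 + v 2, 10 * v 0 + v 3, -5 * v 0 + v 4])
    {v : Fin 5 → ℚ} (hv : v ∈ pingPongSet B false) : T • v ∈ pingPongSet B true := by
  obtain ⟨k, hk₁, hk₂, u, hu | hu, rfl⟩ := hv
  · exact smul_pow_smul_mem hB hT hk₁ hk₂ hu
  · simpa using neg_mem_pingPongSet (smul_pow_smul_mem hB hT hk₁ hk₂ hu)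

theorem pow_smul_mem_pingPongSet_false {k : ℕ} (hk₁ : 1 ≤ k) (hk₂ : k ≤ 4)
    {v : Fin 5 → ℚ} (hv : v ∈ pingPongSet B true) : B ^ k • v ∈ pingPongSet B false :=
  ⟨k, hk₁, hk₂, v, hv, rfl⟩

/-- Every `B ^ k` that is not `±1` maps some point of the second ping-pong set into it. -/
theorem exists_pow_smul_mem_pingPongSet_false (hB5 : B ^ 5 = -1) {k : ℕ} (hk₁ : 1 ≤ k)
    (hk₂ : k ≤ 4) : ∃ v ∈ pingPongSet B false, B ^ k • v ∈ pingPongSet B false := by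
  obtain ⟨u, hu⟩ := pingPongSet_nonempty (B := B) true
  obtain hk | rfl : k ≤ 3 ∨ k = 4 := by omega
  · refine ⟨B ^ 1 • u, pow_smul_mem_pingPongSet_false le_rfl (by norm_num) hu, ?_⟩
    rw [← mul_smul, ← pow_add]
    exact pow_smul_mem_pingPongSet_false (by omega) (by omega) hu
  · refine ⟨B ^ 2 • u, pow_smul_mem_pingPongSet_false (by norm_num) (by norm_num) hu, ?_⟩
    rw [← mul_smul, ← pow_add, show 4 + 2 = 5 + 1 from rfl, pow_add, hB5, neg_one_mul, GL.neg_smul]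
    exact neg_mem_pingPongSet (pow_smul_mem_pingPongSet_false le_rfl (by norm_num) hu)

end Action

/-! ### The matrices -/

theorem companionMatrix_X_sub_one_pow :
    companionMatrix ((X - 1) ^ 5) =
      !![0, 0, 0, 0, 1; 1, 0, 0, 0, -5; 0, 1, 0, 0, 10; 0, 0, 1, 0, -10; 0, 0, 0, 1, 5] := by
  have h : ((X - 1) ^ 5 : ℚ[X]) =
      X ^ 5 - C 5 * X ^ 4 + C 10 * X ^ 3 - C 10 * X ^ 2 + C 5 * X ^ 1 - C 1 := by
    simp only [map_ofNat, map_one]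
    ring
  rw [h]
  ext i j
  fin_cases i <;> fin_cases j <;>
    simp [companionMatrix, coeff_X_pow, coeff_one, coeff_X]

theorem companionMatrix_X_pow_add_one :
    companionMatrix ((X + 1) * (X ^ 4 - X ^ 3 + X ^ 2 - X + 1)) =
      !![0, 0, 0, 0, -1; 1, 0, 0, 0, 0; 0, 1, 0, 0, 0; 0, 0, 1, 0, 0; 0, 0, 0, 1, 0] := by
  have h : ((X + 1) * (X ^ 4 - X ^ 3 + X ^ 2 - X + 1) : ℚ[X]) = X ^ 5 + C 1 := by
    simp only [map_one]
    ring
  rw [h]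
  ext i j
  fin_cases i <;> fin_cases j <;> simp [companionMatrix, coeff_X_pow, coeff_C, -map_one]

section Companion

variable {A B T : GL (Fin 5) ℚ}

theorem smul_of_eq_companionMatrix_X_pow_add_one
    (hB : (↑B : Matrix (Fin 5) (Fin 5) ℚ) =
      companionMatrix ((X + 1) * (X ^ 4 - X ^ 3 + X ^ 2 - X + 1))) (v : Fin 5 → ℚ) :
    B • v = ![-v 4, v 0, v 1, v 2, v 3] := by
  change (↑B : Matrix (Fin 5) (Fin 5) ℚ) *ᵥ v = _
  rw [hB, companionMatrix_X_pow_add_one]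
  ext i
  fin_cases i <;> simp [Matrix.mulVec, dotProduct, Fin.sum_univ_five]

theorem smul_of_eq_companionMatrix_X_sub_one_pow
    (hA : (↑A : Matrix (Fin 5) (Fin 5) ℚ) = companionMatrix ((X - 1) ^ 5)) (v : Fin 5 → ℚ) :
    A • v = ![v 4, v 0 - 5 * v 4, v 1 + 10 * v 4, v 2 - 10 * v 4, v 3 + 5 * v 4] := by
  change (↑A : Matrix (Fin 5) (Fin 5) ℚ) *ᵥ v = _
  rw [hA, companionMatrix_X_sub_one_pow]
  ext i
  fin_cases i <;> simp [Matrix.mulVec, dotProduct, Fin.sum_univ_five, sub_eq_add_neg]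

theorem smul_of_eq_mul_inv
    (hA : (↑A : Matrix (Fin 5) (Fin 5) ℚ) = companionMatrix ((X - 1) ^ 5))
    (hB : (↑B : Matrix (Fin 5) (Fin 5) ℚ) =
      companionMatrix ((X + 1) * (X ^ 4 - X ^ 3 + X ^ 2 - X + 1)))
    (hT : T = B * A⁻¹) (v : Fin 5 → ℚ) :
    T • v = ![-v 0, 5 * v 0 + v 1, -10 * v 0 + v 2, 10 * v 0 + v 3, -5 * v 0 + v 4] := by
  obtain ⟨w, rfl⟩ : ∃ w, A • w = v := ⟨A⁻¹ • v, smul_inv_smul A v⟩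
  rw [hT, mul_smul, inv_smul_smul, smul_of_eq_companionMatrix_X_pow_add_one hB,
    smul_of_eq_companionMatrix_X_sub_one_pow hA]
  ext i
  fin_cases i <;> simp

end Companion

theorem GL.ext_smul {n : Type*} [Fintype n] [DecidableEq n] {R : Type*} [CommRing R] {g h : GL n R}
    (H : ∀ v : n → R, g • v = h • v) : g = h :=
  Units.ext (Matrix.mulVec_injective (funext H))

section Relations

variable {B T : GL (Fin 5) ℚ}

theorem pow_five_eq_neg_one (hB : ∀ v : Fin 5 → ℚ, B • v = ![-v 4, v 0, v 1, v 2, v 3]) :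
    B ^ 5 = -1 := by
  refine GL.ext_smul fun v => ?_
  rw [GL.neg_smul]
  ext i
  fin_cases i <;> simp [pow_succ, mul_smul, hB]

theorem involution_sq (hT : ∀ v : Fin 5 → ℚ,
      T • v = ![-v 0, 5 * v 0 + v 1, -10 * v 0 + v 2, 10 * v 0 + v 3, -5 * v 0 + v 4]) :
    T ^ 2 = 1 := by
  refine GL.ext_smul fun v => ?_
  ext i
  fin_cases i <;> simp [pow_succ, mul_smul, hT]

theorem neg_one_ne_one_GL : (-1 : GL (Fin 5) ℚ) ≠ 1 := by
  intro h
  have := congrFun (congrArg (· • (fun _ => 1 : Fin 5 → ℚ)) h) 0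
  simp at this
  norm_num at this

theorem orderOf_eq_ten (hB : ∀ v : Fin 5 → ℚ, B • v = ![-v 4, v 0, v 1, v 2, v 3]) :
    orderOf B = 10 := by
  have h5 := pow_five_eq_neg_one hB
  refine orderOf_eq_of_pow_and_pow_div_prime (by norm_num) ?_ fun p hp hdvd => ?_
  · rw [show 10 = 5 * 2 from rfl, pow_mul, h5, neg_one_sq]
  · obtain rfl | rfl : p = 2 ∨ p = 5 := by
      have : p ∈ Nat.primeFactors 10 := by simp [hp, hdvd]
      rw [show Nat.primeFactors 10 = {2, 5} by decide +kernel] at this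
      simpa using this
    · simpa [h5] using neg_one_ne_one_GL
    · intro h
      have := congrFun (congrArg (· • (![1, 0, 0, 0, 0] : Fin 5 → ℚ)) h) 0
      simp [pow_succ, mul_smul, hB] at this

theorem not_commute (hB : ∀ v : Fin 5 → ℚ, B • v = ![-v 4, v 0, v 1, v 2, v 3])
    (hT : ∀ v : Fin 5 → ℚ,
      T • v = ![-v 0, 5 * v 0 + v 1, -10 * v 0 + v 2, 10 * v 0 + v 3, -5 * v 0 + v 4]) :
    ¬ Commute T B := by
  intro h
  have := congrFun (congrArg (· • (![1, 0, 0, 0, 0] : Fin 5 → ℚ)) h.eq) 0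
  simp [mul_smul, hB, hT] at this

end Relations

theorem commute_of_mem_closure {G : Type*} [Group G] {B x : G}
    (hx : x ∈ Subgroup.closure ({B} : Set G)) : Commute x B := by
  rw [Subgroup.mem_closure_singleton] at hx
  obtain ⟨n, rfl⟩ := hx
  exact (Commute.refl B).zpow_left n

section Presentation

variable {G : Type*} [Group G] [HasDistribNeg G] {T B : G}

theorem closure_inf_closure (hT : T ^ 2 = 1) (hB : B ^ 5 = -1) (hTB : ¬ Commute T B) :
    Subgroup.closure ({-1, T} : Set G) ⊓ Subgroup.closure ({B} : Set G) =
      Subgroup.closure ({-1} : Set G) := by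
  refine le_antisymm (fun x hx => ?_) (le_inf ?_ ?_)
  · rw [mem_closure_neg_one]
    have hxB := commute_of_mem_closure hx.2
    obtain rfl | rfl | rfl | rfl := (mem_closure_neg_one_involution hT).1 hx.1
    · exact Or.inl rfl
    · exact Or.inr rfl
    · exact absurd hxB hTB
    · exact absurd (by simpa using hxB.neg_left) hTB
  · exact Subgroup.closure_mono (by simp)
  · rw [Subgroup.closure_le, Set.singleton_subset_iff, ← hB]
    exact pow_mem (Subgroup.mem_closure_singleton_self B) 5

theorem card_closure_neg_one_involution (hT : T ^ 2 = 1) (h : (-1 : G) ≠ 1) (hT₁ : T ≠ 1)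
    (hT₂ : T ≠ -1) : Nat.card (Subgroup.closure ({-1, T} : Set G)) = 4 := by
  classical
  have hset : (Subgroup.closure ({-1, T} : Set G) : Set G) =
      (({1, -1, T, -T} : Finset G) : Set G) := by
    ext x
    simp [mem_closure_neg_one_involution hT]
  have hTT : T ≠ -T := by
    intro hTT
    apply h
    have := congrArg (· * T⁻¹) hTT
    simpa using this.symm
  have hT₃ : (1 : G) ≠ -T := fun h' => hT₂ (by rw [h', neg_neg])
  have hT₄ : (-1 : G) ≠ -T := fun h' => hT₁ (neg_injective h').symm
  rw [← SetLike.coe_sort_coe, hset, Nat.card_coe_set_eq, Set.ncard_coe_finset]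
  simp [Finset.card_insert_of_notMem, h.symm, hT₁.symm, hT₂.symm, hTT, hT₃, hT₄]

end Presentation

/-- The homomorphism from an abstract amalgamated product of two subgroups induced by their
inclusions. -/
def amalgamHom {G : Type*} [Group G] {H G₁ G₂ : Subgroup G}
    (h₁ : H ≤ G₁) (h₂ : H ≤ G₂) :
    Monoid.PushoutI (boolFamIncl h₁ h₂) →* G :=
  Monoid.PushoutI.lift (boolFamSubtype G₁ G₂) H.subtype (boolFamSubtype_comp_incl h₁ h₂)

theorem amalgamHom_range {G : Type*} [Group G] {H G₁ G₂ : Subgroup G}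
    (h₁ : H ≤ G₁) (h₂ : H ≤ G₂) :
    (amalgamHom h₁ h₂).range = G₁ ⊔ G₂ := by
  apply le_antisymm
  · rintro _ ⟨w, rfl⟩
    induction w using Monoid.PushoutI.induction_on with
    | of i g =>
      rw [amalgamHom, Monoid.PushoutI.lift_of]
      cases i
      · exact le_sup_right (a := G₁) g.2
      · exact le_sup_left (b := G₂) g.2
    | base h =>
      rw [amalgamHom, Monoid.PushoutI.lift_base]
      exact le_sup_left (b := G₂) (h₁ h.2)
    | mul x y hx hy =>
      rw [map_mul]
      exact mul_mem hx hy
  · refine sup_le (fun x hx => ⟨.of true ⟨x, hx⟩, ?_⟩) fun x hx => ⟨.of false ⟨x, hx⟩, ?_⟩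
    · exact Monoid.PushoutI.lift_of ..
    · exact Monoid.PushoutI.lift_of ..

section Amalgam

variable {B T : GL (Fin 5) ℚ}

theorem smul_mem_pingPongSet_of_mem_closure {x : GL (Fin 5) ℚ}
    (hx : x ∈ Subgroup.closure ({-1} : Set (GL (Fin 5) ℚ))) {b : Bool} {v : Fin 5 → ℚ}
    (hv : v ∈ pingPongSet B b) : x • v ∈ pingPongSet B b := by
  obtain rfl | rfl := mem_closure_neg_one.1 hx
  · rwa [one_smul]
  · rw [GL.neg_smul, one_smul]
    exact neg_mem_pingPongSet hv

theorem mapsPingPong_true (hB : ∀ v : Fin 5 → ℚ, B • v = ![-v 4, v 0, v 1, v 2, v 3])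
    (hT : ∀ v : Fin 5 → ℚ,
      T • v = ![-v 0, 5 * v 0 + v 1, -10 * v 0 + v 2, 10 * v 0 + v 3, -5 * v 0 + v 4])
    {x : GL (Fin 5) ℚ} (hx : x ∈ Subgroup.closure ({-1, T} : Set (GL (Fin 5) ℚ)))
    (hx' : x ∉ Subgroup.closure ({-1} : Set (GL (Fin 5) ℚ))) :
    Monoid.PushoutI.MapsPingPong (pingPongSet B) false true true x := by
  refine ⟨fun k hk v hv => ?_, by simp⟩
  obtain rfl : k = false := by simpa using hk
  obtain rfl | rfl | rfl | rfl := (mem_closure_neg_one_involution (involution_sq hT)).1 hx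
  · exact absurd (one_mem _) hx'
  · exact absurd (Subgroup.mem_closure_singleton_self _) hx'
  · exact smul_mem_pingPongSet_true hB hT hv
  · rw [GL.neg_smul]
    exact neg_mem_pingPongSet (smul_mem_pingPongSet_true hB hT hv)

theorem mapsPingPong_false (hB5 : B ^ 5 = -1)
    {x : GL (Fin 5) ℚ} (hx : x ∈ Subgroup.closure ({B} : Set (GL (Fin 5) ℚ)))
    (hx' : x ∉ Subgroup.closure ({-1} : Set (GL (Fin 5) ℚ))) :
    Monoid.PushoutI.MapsPingPong (pingPongSet B) false false false x := by
  obtain ⟨k, hk, hxk⟩ := eq_pow_or_neg_of_mem_closure hB5 hx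
  have hk₁ : 1 ≤ k := by
    rw [Nat.one_le_iff_ne_zero]
    rintro rfl
    exact hx' (mem_closure_neg_one.2 (by simpa using hxk))
  have hk₂ : k ≤ 4 := by omega
  have key : ∀ v, B ^ k • v ∈ pingPongSet B false → x • v ∈ pingPongSet B false := by
    intro v hv
    obtain rfl | rfl := hxk
    · exact hv
    · rw [GL.neg_smul]
      exact neg_mem_pingPongSet hv
  refine ⟨fun l hl v hv => ?_, fun _ => ?_⟩
  · obtain rfl : l = true := by simpa using hl
    exact key v (pow_smul_mem_pingPongSet_false hk₁ hk₂ hv)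
  · obtain ⟨v, hv, hv'⟩ := exists_pow_smul_mem_pingPongSet_false hB5 hk₁ hk₂
    exact ⟨v, hv, key v hv'⟩

theorem amalgamHom_injective (hB : ∀ v : Fin 5 → ℚ, B • v = ![-v 4, v 0, v 1, v 2, v 3])
    (hT : ∀ v : Fin 5 → ℚ,
      T • v = ![-v 0, 5 * v 0 + v 1, -10 * v 0 + v 2, 10 * v 0 + v 3, -5 * v 0 + v 4])
    (h₁ : Subgroup.closure ({-1} : Set (GL (Fin 5) ℚ)) ≤ Subgroup.closure {-1, T})
    (h₂ : Subgroup.closure ({-1} : Set (GL (Fin 5) ℚ)) ≤ Subgroup.closure {B}) :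
    Function.Injective (amalgamHom h₁ h₂) := by
  have hbase : ∀ h, amalgamHom h₁ h₂ (.base _ h) = h := fun h => Monoid.PushoutI.lift_base ..
  refine Monoid.PushoutI.injective_of_ping_pong (boolFamIncl_injective h₁ h₂) _ (pingPongSet B)
    false pingPongSet_nonempty ?_ ?_ ?_ ?_
  · rintro (_ | _) (_ | _) h
    · exact absurd rfl h
    · exact (disjoint_pingPongSet hB).symm
    · exact disjoint_pingPongSet hB
    · exact absurd rfl h
  · intro h hh
    rw [hbase] at hh
    exact Subtype.ext hh
  · intro h b v hv
    rw [hbase]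
    exact smul_mem_pingPongSet_of_mem_closure h.2 hv
  · rintro (_ | _) g hg
    · rw [amalgamHom, Monoid.PushoutI.lift_of]
      exact mapsPingPong_false (pow_five_eq_neg_one hB) g.2
        fun h => hg (mem_range_boolFamIncl_false h₁ h₂ h)
    · rw [amalgamHom, Monoid.PushoutI.lift_of]
      exact mapsPingPong_true hB hT g.2 fun h => hg (mem_range_boolFamIncl_true h₁ h₂ h)

end Amalgam

/-- `Γ(f,g) = ⟨-1, T⟩ ∗_{⟨-1⟩} ⟨B⟩` for `f = (x-1)⁵`, `g = (x+1)(x⁴-x³+x²-x+1)`. -/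
theorem hypergeometric_amalgamated_product_case7 (A B T : GL (Fin 5) ℚ)
    (hA : (↑A : Matrix (Fin 5) (Fin 5) ℚ) = companionMatrix ((X - 1) ^ 5))
    (hB : (↑B : Matrix (Fin 5) (Fin 5) ℚ) =
      companionMatrix ((X + 1) * (X ^ 4 - X ^ 3 + X ^ 2 - X + 1)))
    (hT : T = B * A⁻¹) :
    T ^ 2 = 1 ∧ T ≠ 1 ∧ T ≠ -1 ∧ orderOf B = 10 ∧ B ^ 5 = -1 ∧
    Nat.card (Subgroup.closure ({-1, T} : Set (GL (Fin 5) ℚ))) = 4 ∧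
    Nat.card (Subgroup.closure ({B} : Set (GL (Fin 5) ℚ))) = 10 ∧
    ((Subgroup.closure ({-1} : Set (GL (Fin 5) ℚ)) : Set (GL (Fin 5) ℚ)) = {1, -1}) ∧
    Subgroup.closure ({-1, T} : Set (GL (Fin 5) ℚ)) ⊓ Subgroup.closure ({B} : Set (GL (Fin 5) ℚ))
      = Subgroup.closure ({-1} : Set (GL (Fin 5) ℚ)) ∧
    ∃ (h₁ : Subgroup.closure ({-1} : Set (GL (Fin 5) ℚ)) ≤
        Subgroup.closure ({-1, T} : Set (GL (Fin 5) ℚ)))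
      (h₂ : Subgroup.closure ({-1} : Set (GL (Fin 5) ℚ)) ≤
        Subgroup.closure ({B} : Set (GL (Fin 5) ℚ)))
      (ψ : Monoid.PushoutI (boolFamIncl h₁ h₂) →* GL (Fin 5) ℚ),
      (∀ x : ↥(Subgroup.closure ({-1, T} : Set (GL (Fin 5) ℚ))),
        ψ (Monoid.PushoutI.of (φ := boolFamIncl h₁ h₂) true x) = ↑x) ∧
      (∀ y : ↥(Subgroup.closure ({B} : Set (GL (Fin 5) ℚ))),
        ψ (Monoid.PushoutI.of (φ := boolFamIncl h₁ h₂) false y) = ↑y) ∧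
      Function.Injective ψ ∧
      ψ.range = Subgroup.closure {A, B} := by
  have hBv := smul_of_eq_companionMatrix_X_pow_add_one hB
  have hTv := smul_of_eq_mul_inv hA hB hT
  have hT2 := involution_sq hTv
  have hB5 := pow_five_eq_neg_one hBv
  have hTB := not_commute hBv hTv
  have hT₁ : T ≠ 1 := by
    rintro rfl
    exact hTB (Commute.one_left B)
  have hT₂ : T ≠ -1 := by
    rintro rfl
    exact hTB (Commute.neg_one_left B)
  have hinf := closure_inf_closure hT2 hB5 hTB
  have h₁ := hinf ▸ inf_le_left
  have h₂ := hinf ▸ inf_le_right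
  refine ⟨hT2, hT₁, hT₂, orderOf_eq_ten hBv, hB5,
    card_closure_neg_one_involution hT2 neg_one_ne_one_GL hT₁ hT₂, ?_, ?_, hinf, h₁, h₂,
    amalgamHom h₁ h₂, fun x => Monoid.PushoutI.lift_of .., fun y => Monoid.PushoutI.lift_of ..,
    amalgamHom_injective hBv hTv h₁ h₂, ?_⟩
  · rw [← Subgroup.zpowers_eq_closure, Nat.card_zpowers, orderOf_eq_ten hBv]
  · ext x
    exact mem_closure_neg_one
  · rw [amalgamHom_range]
    have hAB : A = T⁻¹ * B := by simp [hT]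
    have hA' : A ∈ Subgroup.closure {A, B} := Subgroup.subset_closure (by simp)
    have hB' : B ∈ Subgroup.closure {A, B} := Subgroup.subset_closure (by simp)
    have hT' : T ∈ Subgroup.closure {-1, T} ⊔ Subgroup.closure {B} :=
      le_sup_left (b := Subgroup.closure {B}) (Subgroup.subset_closure (by simp))
    have hB'' : B ∈ Subgroup.closure {-1, T} ⊔ Subgroup.closure {B} :=
      le_sup_right (a := Subgroup.closure {-1, T}) (Subgroup.mem_closure_singleton_self B)
    apply le_antisymm
    · refine sup_le ?_ ?_ <;> rw [Subgroup.closure_le]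
      · rintro _ (rfl | rfl)
        · exact hB5 ▸ pow_mem hB' 5
        · exact hT ▸ mul_mem hB' (inv_mem hA')
      · rintro _ rfl
        exact hB'
    · rw [Subgroup.closure_le]
      rintro _ (rfl | rfl)
      · exact hAB ▸ mul_mem (inv_mem hT') hB''
      · exact hB''
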